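/- arXiv:1410.5925 — 14 statements merged into one kernel-verified Lean document; each statement's English description precedes it below -/
import Mathlib

section
/- Let A be a real symmetric n×n matrix, B a nonzero real m×n matrix, c ∈ ℝ^m, d ∈ ℝ, f ∈ ℝ^n, and define the double well potential function g(x) = ½(½‖Bx − c‖² − d)² + ½xᵀAx − fᵀx. If there exists a vector u ∈ ℝ^n with Bu = 0 and uᵀAu < 0, then g is unbounded below on ℝ^n. -/
open Matrix
open scoped BigOperators

/-- A real quadratic polynomial with negative leading coefficient has no lower bound. -/
lemma exists_quadratic_lt_of_neg {a : ℝ} (ha : a < 0) (b k L : ℝ) :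
    ∃ t : ℝ, a * t ^ 2 + b * t + k < L := by
  by_contra! h
  have h0 : 0 ≤ (k - L) / -a := div_nonneg (by simpa using h 0) (by linarith)
  have hsq := Real.sq_sqrt (add_nonneg h0 zero_le_one)
  have hpos := h √((k - L) / -a + 1)
  have hneg := h (-√((k - L) / -a + 1))
  rw [neg_sq] at hneg
  rw [hsq] at hpos hneg
  have hmul : a * ((k - L) / -a + 1) = a - (k - L) := by
    field_simp [ha.ne]
    ring
  linarith

/-- If there is `u` with `Bu = 0` and `uᵀAu < 0`, then the double well
potential function `g(x) = ½(½‖Bx − c‖² − d)² + ½xᵀAx − fᵀx` is unbounded below. -/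
theorem dwp_unbounded_below_of_negative_null_direction
    (n m : ℕ) (A : Matrix (Fin n) (Fin n) ℝ) (hA : A.IsSymm)
    (B : Matrix (Fin m) (Fin n) ℝ) (hB : B ≠ 0)
    (c : Fin m → ℝ) (d : ℝ) (f : Fin n → ℝ)
    (g : (Fin n → ℝ) → ℝ)
    (hg : ∀ x, g x =
      (1/2) * ((1/2) * ((B.mulVec x - c) ⬝ᵥ (B.mulVec x - c)) - d)^2
        + (1/2) * (x ⬝ᵥ A.mulVec x) - f ⬝ᵥ x)
    (u : Fin n → ℝ) (hu : B.mulVec u = 0) (huA : u ⬝ᵥ A.mulVec u < 0) :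
    ¬ BddBelow (Set.range g) := by
  rintro ⟨L, hL⟩
  obtain ⟨t, ht⟩ := exists_quadratic_lt_of_neg (a := (1/2) * (u ⬝ᵥ A.mulVec u)) (by linarith)
    (-(f ⬝ᵥ u)) ((1/2) * ((1/2) * (c ⬝ᵥ c) - d)^2) L
  have hgt := hL (Set.mem_range_self (t • u))
  rw [hg] at hgt
  simp only [mulVec_smul, hu, smul_zero, zero_sub, neg_dotProduct_neg, smul_dotProduct,
    dotProduct_smul, smul_eq_mul] at hgt
  linarith
end

section
/- Let A be a real symmetric n×n matrix, B a nonzero real m×n matrix, c ∈ ℝ^m, d ∈ ℝ, f ∈ ℝ^n, and define the double well potential function g(x) = ½(½‖Bx − c‖² − d)² + ½xᵀAx − fᵀx. If there exist vectors u ∈ ℝ^n and x ∈ ℝ^n with Bu = 0, uᵀAu = 0, and uᵀ(Ax − f) ≠ 0, then g is unbounded below on ℝ^n. -/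
open Matrix
open scoped BigOperators

/-- If there are `u, x` with `Bu = 0`, `uᵀAu = 0` and `uᵀ(Ax − f) ≠ 0`, then
the double well potential function `g` is unbounded below. -/
theorem dwp_unbounded_below_of_degenerate_null_direction
    (n m : ℕ) (A : Matrix (Fin n) (Fin n) ℝ) (hA : A.IsSymm)
    (B : Matrix (Fin m) (Fin n) ℝ) (hB : B ≠ 0)
    (c : Fin m → ℝ) (d : ℝ) (f : Fin n → ℝ)
    (g : (Fin n → ℝ) → ℝ)
    (hg : ∀ x, g x =
      (1/2) * ((1/2) * ((B.mulVec x - c) ⬝ᵥ (B.mulVec x - c)) - d)^2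
        + (1/2) * (x ⬝ᵥ A.mulVec x) - f ⬝ᵥ x)
    (u : Fin n → ℝ) (hu : B.mulVec u = 0) (huA : u ⬝ᵥ A.mulVec u = 0)
    (x : Fin n → ℝ) (hx : u ⬝ᵥ (A.mulVec x - f) ≠ 0) :
    ¬ BddBelow (Set.range g) := by
  have symm_form : x ⬝ᵥ A *ᵥ u = u ⬝ᵥ A *ᵥ x := by
    rw [dotProduct_mulVec, ← mulVec_transpose, hA.eq, dotProduct_comm]
  have g_line : ∀ t : ℝ, g (x + t • u) = g x + t * (u ⬝ᵥ (A *ᵥ x - f)) := by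
    intro t
    rw [hg, hg]
    simp only [mulVec_add, mulVec_smul, hu, smul_zero, add_zero, add_dotProduct, dotProduct_add,
      smul_dotProduct, dotProduct_smul, smul_eq_mul, huA, symm_form, dotProduct_sub,
      dotProduct_comm f u]
    ring
  rintro ⟨b, hb⟩
  have h := hb (Set.mem_range_self (x + ((b - 1 - g x) / (u ⬝ᵥ (A *ᵥ x - f))) • u))
  rw [g_line, div_mul_cancel₀ _ hx] at h
  linarith
end

section
/- The canonical dual function Πᵈ(σ) = −½σ² − ½ Σᵢ₌₁ⁿ (ψᵢ + σφᵢ)²/(αᵢ + σ) − νσ is concave on the open interval (σ₀, +∞), where σ₀ = max{−α₁, …, −αₙ}. -/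
open scoped BigOperators

/-- The concave parabola `t ↦ 2 t p - t² q` is bounded above by `p² / q`. -/
lemma two_mul_sub_sq_mul_le_sq_div (p t : ℝ) {q : ℝ} (hq : 0 < q) :
    2 * t * p - t ^ 2 * q ≤ p ^ 2 / q := by
  rw [le_div_iff₀ hq]
  nlinarith [sq_nonneg (p - t * q)]

/-- The quotient of the square of an affine function by a positive translate is convex. -/
lemma convexOn_sq_affine_div (a p f s : ℝ) (hs : -a ≤ s) :
    ConvexOn ℝ (Set.Ioi s) (fun x => (p + x * f) ^ 2 / (a + x)) := by
  refine ⟨convex_Ioi s, fun x hx y hy u v hu hv huv => ?_⟩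
  have hz : u • x + v • y ∈ Set.Ioi s := convex_Ioi s hx hy hu hv huv
  simp only [Set.mem_Ioi, smul_eq_mul] at hx hy hz ⊢
  have hq : 0 < a + (u * x + v * y) := by linarith
  set t := (p + (u * x + v * y) * f) / (a + (u * x + v * y))
  have htq : t * (a + (u * x + v * y)) = p + (u * x + v * y) * f :=
    div_mul_cancel₀ _ hq.ne'
  have hxt := mul_le_mul_of_nonneg_left
    (two_mul_sub_sq_mul_le_sq_div (p + x * f) t (q := a + x) (by linarith)) hu
  have hyt := mul_le_mul_of_nonneg_left
    (two_mul_sub_sq_mul_le_sq_div (p + y * f) t (q := a + y) (by linarith)) hv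
  refine le_trans (le_of_eq ?_) (add_le_add hxt hyt)
  rw [← htq, mul_pow, sq (a + _), ← mul_assoc, mul_div_cancel_right₀ _ hq.ne']
  obtain rfl : v = 1 - u := by linarith
  linear_combination 2 * t * htq

/-- The canonical dual function
`Πᵈ(σ) = −½σ² − ½ Σᵢ (ψᵢ + σφᵢ)²/(αᵢ + σ) − νσ` is concave on `(σ₀, +∞)`,
where `σ₀ = max{−α₁, …, −αₙ}`. -/
theorem canonical_dual_concaveOn
    (n : ℕ) (α ψ φ : Fin n → ℝ) (ν σ₀ : ℝ)
    (hσ₀ : IsGreatest (Set.range fun i => -α i) σ₀) :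
    ConcaveOn ℝ (Set.Ioi σ₀)
      (fun σ => -(1/2) * σ^2 - (1/2) * ∑ i, (ψ i + σ * φ i)^2 / (α i + σ) - ν * σ) := by
  have hsum : ConvexOn ℝ (Set.Ioi σ₀) (fun σ => ∑ i, (ψ i + σ * φ i) ^ 2 / (α i + σ)) := by
    refine ⟨convex_Ioi σ₀, fun x hx y hy u v hu hv huv => ?_⟩
    simp only [Finset.smul_sum, ← Finset.sum_add_distrib]
    exact Finset.sum_le_sum fun i _ =>
      (convexOn_sq_affine_div (α i) (ψ i) (φ i) σ₀ (hσ₀.2 ⟨i, rfl⟩)).2 hx hy hu hv huv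
  refine ⟨convex_Ioi σ₀, fun x hx y hy u v hu hv huv => ?_⟩
  have h := hsum.2 hx hy hu hv huv
  simp only [smul_eq_mul] at h ⊢
  obtain rfl : v = 1 - u := by linarith
  nlinarith [mul_nonneg (mul_nonneg hu hv) (sq_nonneg (x - y))]
end

section
/- For every σ ∈ (σ₀, +∞), the canonical dual function Πᵈ(σ) = −½σ² − ½ Σᵢ₌₁ⁿ (ψᵢ + σφᵢ)²/(αᵢ + σ) − νσ is differentiable at σ and its derivative equals Λ(w(σ)) − σ, where w(σ)ᵢ = (ψᵢ + σφᵢ)/(αᵢ + σ) and Λ(w) = Σᵢ₌₁ⁿ (½wᵢ² − φᵢwᵢ) − ν. -/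
open scoped BigOperators

/-- Derivative of a single summand of the canonical dual function. -/
lemma hasDerivAt_sq_div_add (a p f x : ℝ) (h : a + x ≠ 0) :
    HasDerivAt (fun s => (p + s * f) ^ 2 / (a + s))
      (-2 * ((1/2) * ((p + x * f) / (a + x)) ^ 2 - f * ((p + x * f) / (a + x)))) x := by
  have hnum : HasDerivAt (fun s => p + s * f) (1 * f) x :=
    ((hasDerivAt_id' x).mul_const f).const_add p
  have hden : HasDerivAt (fun s => a + s) 1 x := (hasDerivAt_id' x).const_add a
  refine ((hnum.fun_pow 2).fun_div hden h).congr_deriv ?_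
  field_simp
  push_cast
  ring

/-- For `σ ∈ (σ₀, +∞)`, the canonical dual function `Πᵈ` is differentiable
at `σ` with derivative `Λ(w(σ)) − σ`, where `w(σ)ᵢ = (ψᵢ + σφᵢ)/(αᵢ + σ)` and
`Λ(w) = Σᵢ (½wᵢ² − φᵢwᵢ) − ν`. -/
theorem canonical_dual_hasDerivAt
    (n : ℕ) (α ψ φ : Fin n → ℝ) (ν σ₀ : ℝ)
    (hσ₀ : IsGreatest (Set.range fun i => -α i) σ₀)
    (σ : ℝ) (hσ : σ ∈ Set.Ioi σ₀) :
    HasDerivAt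
      (fun s => -(1/2) * s^2 - (1/2) * ∑ i, (ψ i + s * φ i)^2 / (α i + s) - ν * s)
      ((∑ i, ((1/2) * ((ψ i + σ * φ i) / (α i + σ))^2
          - φ i * ((ψ i + σ * φ i) / (α i + σ))) - ν) - σ)
      σ := by
  have hpos : ∀ i, α i + σ ≠ 0 := fun i => by
    have h₁ : -α i ≤ σ₀ := hσ₀.2 ⟨i, rfl⟩
    have h₂ : σ₀ < σ := hσ
    exact ne_of_gt (by linarith)
  have hsum := HasDerivAt.fun_sum (u := Finset.univ) fun i _ =>
    hasDerivAt_sq_div_add (α i) (ψ i) (φ i) σ (hpos i)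
  refine (((((hasDerivAt_id' σ).fun_pow 2).const_mul (-(1/2))).fun_sub
    (hsum.const_mul (1/2))).fun_sub ((hasDerivAt_id' σ).const_mul ν)).congr_deriv ?_
  rw [← Finset.mul_sum]
  push_cast
  ring
end

section
/- (Weak duality) For every σ ∈ (σ₀, +∞) and every feasible pair (ξ, w) ∈ ℝ × ℝⁿ satisfying ξ = Σᵢ₌₁ⁿ (½wᵢ² − φᵢwᵢ) − ν, the dual value Πᵈ(σ) = −½σ² − ½ Σᵢ₌₁ⁿ (ψᵢ + σφᵢ)²/(αᵢ + σ) − νσ is at most the primal value Π(ξ, w) = ½ξ² + Σᵢ₌₁ⁿ (½αᵢwᵢ² − ψᵢwᵢ). -/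
open scoped BigOperators

/-- Weak duality: For every `σ ∈ (σ₀, +∞)` and every feasible pair
`(ξ, w)` with `ξ = Σᵢ (½wᵢ² − φᵢwᵢ) − ν`, one has `Πᵈ(σ) ≤ Π(ξ, w)`. -/
theorem weak_duality
    (n : ℕ) (α ψ φ : Fin n → ℝ) (ν σ₀ : ℝ)
    (hσ₀ : IsGreatest (Set.range fun i => -α i) σ₀)
    (σ : ℝ) (hσ : σ ∈ Set.Ioi σ₀)
    (ξ : ℝ) (w : Fin n → ℝ)
    (hfeas : ξ = ∑ i, ((1/2) * (w i)^2 - φ i * w i) - ν) :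
    -(1/2) * σ^2 - (1/2) * ∑ i, (ψ i + σ * φ i)^2 / (α i + σ) - ν * σ
      ≤ (1/2) * ξ^2 + ∑ i, ((1/2) * α i * (w i)^2 - ψ i * w i) := by
  have hterm : ∀ i ∈ Finset.univ, -(1/2) * ((ψ i + σ * φ i)^2 / (α i + σ)) ≤
      ((1/2) * α i * (w i)^2 - ψ i * w i) + σ * ((1/2) * (w i)^2 - φ i * w i) := by
    intro i _
    have hle : -α i ≤ σ₀ := hσ₀.2 ⟨i, rfl⟩
    have hpos : 0 < α i + σ := by
      have := Set.mem_Ioi.mp hσ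
      linarith
    have hsq : 0 ≤ ((α i + σ) * w i - (ψ i + σ * φ i))^2 / (2 * (α i + σ)) := by positivity
    have heq : ((α i + σ) * w i - (ψ i + σ * φ i))^2 / (2 * (α i + σ)) =
        ((1/2) * α i * (w i)^2 - ψ i * w i) + σ * ((1/2) * (w i)^2 - φ i * w i)
          + (1/2) * ((ψ i + σ * φ i)^2 / (α i + σ)) := by
      field_simp
      ring
    linarith
  have hsum := Finset.sum_le_sum hterm
  rw [Finset.sum_add_distrib, ← Finset.mul_sum, ← Finset.mul_sum] at hsum
  have hconstraint : ∑ i, ((1/2) * (w i)^2 - φ i * w i) = ξ + ν := by linarith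
  rw [hconstraint] at hsum
  nlinarith [sq_nonneg (ξ - σ)]
end

section
/- (Strong duality at an interior critical point) Suppose σ* ∈ (σ₀, +∞) satisfies Σᵢ₌₁ⁿ (½w(σ*)ᵢ² − φᵢw(σ*)ᵢ) − ν − σ* = 0, where w(σ*)ᵢ = (ψᵢ + σ*φᵢ)/(αᵢ + σ*). Then the pair (ξ*, w*) = (σ*, w(σ*)) is feasible for the canonical primal problem (P) and is a global minimizer of Π over the feasible set E_a, and the optimal primal value Π(ξ*, w*) equals the dual value Πᵈ(σ*). -/
open scoped BigOperators

/-- The value of the quadratic `½ a x² - b x` at its critical point `b / a`. -/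
theorem half_mul_sq_sub_mul_div {a : ℝ} (ha : a ≠ 0) (b : ℝ) :
    (1/2) * a * (b / a)^2 - b * (b / a) = -(1/2) * (b^2 / a) := by
  field_simp
  ring

/-- A quadratic `½ a x² - b x` with `a > 0` is bounded below by `-½ b² / a`. -/
theorem neg_half_sq_div_le {a : ℝ} (ha : 0 < a) (b x : ℝ) :
    -(1/2) * (b^2 / a) ≤ (1/2) * a * x^2 - b * x := by
  have h : (1/2) * a * x^2 - b * x - -(1/2) * (b^2 / a) = (1/2) * a * (x - b / a)^2 := by
    field_simp
    ring
  have : 0 ≤ (1/2) * a * (x - b / a)^2 := by positivity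
  linarith

/-- The Lagrangian of the primal problem separates into quadratics in each coordinate. -/
theorem lagrangian_eq_sum {ι : Type*} [Fintype ι] (α ψ φ w : ι → ℝ) (σ : ℝ) :
    ∑ i, ((1/2) * α i * (w i)^2 - ψ i * w i) + σ * ∑ i, ((1/2) * (w i)^2 - φ i * w i)
      = ∑ i, ((1/2) * (α i + σ) * (w i)^2 - (ψ i + σ * φ i) * w i) := by
  rw [Finset.mul_sum, ← Finset.sum_add_distrib]
  exact Finset.sum_congr rfl fun i _ => by ring

/-- Strong duality at an interior critical point: If `σ* ∈ (σ₀, +∞)`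
satisfies `Σᵢ (½w(σ*)ᵢ² − φᵢw(σ*)ᵢ) − ν − σ* = 0` with
`w(σ*)ᵢ = (ψᵢ + σ*φᵢ)/(αᵢ + σ*)`, then `(σ*, w(σ*))` is feasible for (P), is a global
minimizer of `Π` over the feasible set, and the primal optimal value equals `Πᵈ(σ*)`. -/
theorem strong_duality_interior_critical_point
    (n : ℕ) (α ψ φ : Fin n → ℝ) (ν σ₀ : ℝ)
    (hσ₀ : IsGreatest (Set.range fun i => -α i) σ₀)
    (σs : ℝ) (hσs : σs ∈ Set.Ioi σ₀)
    (hcrit : ∑ i, ((1/2) * ((ψ i + σs * φ i) / (α i + σs))^2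
        - φ i * ((ψ i + σs * φ i) / (α i + σs))) - ν - σs = 0) :
    (σs = ∑ i, ((1/2) * ((ψ i + σs * φ i) / (α i + σs))^2
        - φ i * ((ψ i + σs * φ i) / (α i + σs))) - ν) ∧
    (∀ ξ : ℝ, ∀ w : Fin n → ℝ, ξ = ∑ i, ((1/2) * (w i)^2 - φ i * w i) - ν →
      (1/2) * σs^2 + ∑ i, ((1/2) * α i * ((ψ i + σs * φ i) / (α i + σs))^2
          - ψ i * ((ψ i + σs * φ i) / (α i + σs)))
        ≤ (1/2) * ξ^2 + ∑ i, ((1/2) * α i * (w i)^2 - ψ i * w i)) ∧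
    (1/2) * σs^2 + ∑ i, ((1/2) * α i * ((ψ i + σs * φ i) / (α i + σs))^2
        - ψ i * ((ψ i + σs * φ i) / (α i + σs)))
      = -(1/2) * σs^2 - (1/2) * ∑ i, (ψ i + σs * φ i)^2 / (α i + σs) - ν * σs := by
  have hpos : ∀ i, 0 < α i + σs := fun i => by
    have h₁ : -α i ≤ σ₀ := hσ₀.2 ⟨i, rfl⟩
    have h₂ : σ₀ < σs := hσs
    linarith
  have hdual : (1/2) * σs^2 + ∑ i, ((1/2) * α i * ((ψ i + σs * φ i) / (α i + σs))^2
        - ψ i * ((ψ i + σs * φ i) / (α i + σs)))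
      = -(1/2) * σs^2 - (1/2) * ∑ i, (ψ i + σs * φ i)^2 / (α i + σs) - ν * σs := by
    have hL := lagrangian_eq_sum α ψ φ (fun i => (ψ i + σs * φ i) / (α i + σs)) σs
    simp only [half_mul_sq_sub_mul_div (hpos _).ne', ← Finset.mul_sum] at hL
    linear_combination hL - σs * hcrit
  refine ⟨by linarith, fun ξ w hξ => ?_, hdual⟩
  have hle : -(1/2) * ∑ i, (ψ i + σs * φ i)^2 / (α i + σs)
      ≤ ∑ i, ((1/2) * (α i + σs) * (w i)^2 - (ψ i + σs * φ i) * w i) := by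
    rw [Finset.mul_sum]
    exact Finset.sum_le_sum fun i _ => neg_half_sq_div_le (hpos i) _ _
  rw [← lagrangian_eq_sum, show ∑ i, ((1/2) * (w i)^2 - φ i * w i) = ξ + ν by linarith] at hle
  rw [hdual]
  nlinarith [sq_nonneg (ξ - σs)]
end

section
/- Suppose the right-hand limit lim_{σ→σ₀⁺} Πᵈ(σ) of the canonical dual function Πᵈ(σ) = −½σ² − ½ Σᵢ₌₁ⁿ (ψᵢ + σφᵢ)²/(αᵢ + σ) − νσ is finite (greater than −∞). Then for every index i with αᵢ + σ₀ = 0, one has ψᵢ + σ₀φᵢ = 0. -/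
open scoped BigOperators

/-- If the right-hand limit of `Πᵈ` at `σ₀` is finite (i.e. `Πᵈ` tends to a
real limit as `σ → σ₀⁺`), then `ψᵢ + σ₀φᵢ = 0` for every index `i` with `αᵢ + σ₀ = 0`. -/
theorem finite_boundary_limit_forces_null_numerators
    (n : ℕ) (α ψ φ : Fin n → ℝ) (ν σ₀ : ℝ)
    (hσ₀ : IsGreatest (Set.range fun i => -α i) σ₀)
    (Lv : ℝ)
    (hlim : Filter.Tendsto
      (fun σ => -(1/2) * σ^2 - (1/2) * ∑ i, (ψ i + σ * φ i)^2 / (α i + σ) - ν * σ)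
      (nhdsWithin σ₀ (Set.Ioi σ₀)) (nhds Lv)) :
    ∀ i, α i + σ₀ = 0 → ψ i + σ₀ * φ i = 0 := by
  intro i hi
  have hpos : ∀ j, ∀ σ ∈ Set.Ioi σ₀, 0 < α j + σ := fun j σ hσ => by
    have hj : -α j ≤ σ₀ := hσ₀.2 ⟨j, rfl⟩
    have : σ₀ < σ := hσ
    linarith
  have tendsto_of_continuous {g : ℝ → ℝ} (hg : Continuous g) :
      Filter.Tendsto g (nhdsWithin σ₀ (Set.Ioi σ₀)) (nhds (g σ₀)) :=
    hg.continuousAt.tendsto.mono_left nhdsWithin_le_nhds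
  have hnum := tendsto_of_continuous (g := fun σ => (ψ i + σ * φ i)^2) (by fun_prop)
  have hden := tendsto_of_continuous (g := fun σ => α i + σ) (by fun_prop)
  have hquad := tendsto_of_continuous (g := fun σ => -(1/2) * σ^2 - ν * σ) (by fun_prop)
  have hbound := hden.mul ((hquad.sub hlim).const_mul 2)
  have hle : (ψ i + σ₀ * φ i)^2 ≤ 0 := by
    have h := le_of_tendsto_of_tendsto hnum hbound <| by
      filter_upwards [self_mem_nhdsWithin] with σ hσ
      have hterm : (ψ i + σ * φ i)^2 / (α i + σ) ≤ ∑ j, (ψ j + σ * φ j)^2 / (α j + σ) :=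
        Finset.single_le_sum (f := fun j => (ψ j + σ * φ j)^2 / (α j + σ))
          (fun j _ => div_nonneg (sq_nonneg _) (hpos j σ hσ).le) (Finset.mem_univ i)
      rw [div_le_iff₀' (hpos i σ hσ)] at hterm
      exact hterm.trans_eq (by ring)
    simpa only [hi, zero_mul] using h
  exact pow_eq_zero_iff two_ne_zero |>.1 (le_antisymm hle (sq_nonneg _))
end

section
/- (Theorem 1, boundary case characterization) Let I = {i : αᵢ + σ₀ = 0} and J = {1,…,n} \ I, and suppose I ≠ ∅, ψᵢ + σ₀φᵢ = 0 for all i ∈ I, and sup_{σ ∈ (σ₀,∞)} Πᵈ(σ) = lim_{σ→σ₀⁺} Πᵈ(σ) > −∞. Then a pair (ξ*, w*) ∈ ℝ × ℝⁿ with ξ* = Σᵢ₌₁ⁿ (½(wᵢ*)² − φᵢwᵢ*) − ν is a global minimizer of Π(ξ, w) = ½ξ² + Σᵢ₌₁ⁿ (½αᵢwᵢ² − ψᵢwᵢ) over the feasible set E_a if and only if ξ* = σ₀, w_j* = (ψ_j + σ₀φ_j)/(α_j + σ₀) for every j ∈ J, and Σ_{i∈I} (½(wᵢ*)² − φᵢwᵢ*)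 = −Σ_{j∈J} (½(w_j*)² − φ_jw_j*) + σ₀ + ν; in this case the optimal value equals −½σ₀² − ½ Σ_{j∈J} (ψ_j + σ₀φ_j)²/(α_j + σ₀) − σ₀ν. -/
open scoped BigOperators Classical

/-- Completing the square in the Lagrangian of the constrained quadratic problem: if every
coordinate with vanishing curvature `α i + σ` also has vanishing linear term, then at each
feasible point the primal objective is a constant plus a sum of squares. -/
theorem primal_eq_add_squares {n : ℕ} (α ψ φ w : Fin n → ℝ) (ν σ ξ : ℝ)
    (hψ : ∀ i, α i + σ = 0 → ψ i + σ * φ i = 0)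
    (hξ : ξ = ∑ i, ((1/2) * (w i)^2 - φ i * w i) - ν) :
    (1/2) * ξ^2 + ∑ i, ((1/2) * α i * (w i)^2 - ψ i * w i) =
      (-(1/2) * σ^2 - (1/2) * ∑ i, (ψ i + σ * φ i)^2 / (α i + σ) - σ * ν)
        + (1/2) * (ξ - σ)^2
        + (1/2) * ∑ i, (α i + σ) * (w i - (ψ i + σ * φ i) / (α i + σ))^2 := by
  have hterm : ∀ i, (1/2) * α i * (w i)^2 - ψ i * w i =
      (1/2) * ((α i + σ) * (w i - (ψ i + σ * φ i) / (α i + σ))^2)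
        - (1/2) * ((ψ i + σ * φ i)^2 / (α i + σ))
        - σ * ((1/2) * (w i)^2 - φ i * w i) := by
    intro i
    by_cases h : α i + σ = 0
    · rw [h, hψ i h]
      linear_combination (1/2) * (w i)^2 * h - w i * hψ i h
    · field_simp
      ring
  have hsum : ∑ i, ((1/2) * (w i)^2 - φ i * w i) = ξ + ν := by linarith
  rw [Finset.sum_congr rfl fun i _ => hterm i, Finset.sum_sub_distrib, Finset.sum_sub_distrib,
    ← Finset.mul_sum, ← Finset.mul_sum, ← Finset.mul_sum, hsum]
  ring

/-- Exact second-order expansion of a summand of the dual function. -/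
theorem sq_div_add_expansion {a b p t : ℝ} (ha : a ≠ 0) (hat : a + t ≠ 0) :
    (b + t * p)^2 / (a + t) =
      b^2 / a - 2 * t * ((1/2) * (b / a)^2 - p * (b / a)) + t^2 * ((p - b / a)^2 / (a + t)) := by
  field_simp
  ring

/-- A real number bounded above by all positive multiples of a constant is nonpositive. -/
theorem nonpos_of_forall_pos_le_mul {D K : ℝ} (h : ∀ t, 0 < t → D ≤ t * K) : D ≤ 0 := by
  have hcont : Filter.Tendsto (fun t : ℝ => t * K) (nhdsWithin 0 (Set.Ioi 0)) (nhds 0) := by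
    have hc : Continuous fun t : ℝ => t * K := by fun_prop
    simpa using (hc.tendsto 0).mono_left nhdsWithin_le_nhds
  exact ge_of_tendsto hcont (Filter.eventually_of_mem self_mem_nhdsWithin h)

/-- If the dual function is bounded above on `(σ, ∞)` by its right-hand limit at `σ`, then the
constraint function, evaluated where all its degenerate coordinates are minimal, is at most
`σ + ν`. -/
theorem constraint_le_of_dual_le_limit {n : ℕ} (α ψ φ : Fin n → ℝ) (ν σ L : ℝ)
    (hα : ∀ i, 0 ≤ α i + σ)
    (hψ : ∀ i, α i + σ = 0 → ψ i + σ * φ i = 0)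
    (Pd : ℝ → ℝ)
    (hPd : ∀ s, Pd s = -(1/2) * s^2 - (1/2) * ∑ i, (ψ i + s * φ i)^2 / (α i + s) - ν * s)
    (hlim : Filter.Tendsto Pd (nhdsWithin σ (Set.Ioi σ)) (nhds L))
    (hle : ∀ s, σ < s → Pd s ≤ L) (v : Fin n → ℝ)
    (hv : ∀ i, α i + σ = 0 → v i = φ i)
    (hv' : ∀ i, α i + σ ≠ 0 → v i = (ψ i + σ * φ i) / (α i + σ)) :
    ∑ i, ((1/2) * (v i)^2 - φ i * v i) ≤ σ + ν := by
  set g := ∑ i, ((1/2) * (v i)^2 - φ i * v i) with hg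
  set V := -(1/2) * σ^2 - (1/2) * ∑ i, (ψ i + σ * φ i)^2 / (α i + σ) - ν * σ with hV
  have hterm : ∀ t, 0 < t → ∀ i, (ψ i + (σ + t) * φ i)^2 / (α i + (σ + t)) =
      (ψ i + σ * φ i)^2 / (α i + σ) - 2 * t * ((1/2) * (v i)^2 - φ i * v i)
        + t^2 * ((φ i - v i)^2 / (α i + σ + t)) := by
    intro t ht i
    have hb : ψ i + (σ + t) * φ i = (ψ i + σ * φ i) + t * φ i := by ring
    rw [hb, ← add_assoc]
    by_cases h : α i + σ = 0
    · rw [hv i h, hψ i h, h]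
      field_simp
      ring
    · rw [hv' i h]
      exact sq_div_add_expansion h (by have := hα i; positivity)
  have hexp : ∀ t, 0 < t → Pd (σ + t) = V + t * (g - σ - ν) - (1/2) * t^2
      - (1/2) * t^2 * ∑ i, (φ i - v i)^2 / (α i + σ + t) := by
    intro t ht
    rw [hPd, Finset.sum_congr rfl fun i _ => hterm t ht i, Finset.sum_add_distrib,
      Finset.sum_sub_distrib, ← Finset.mul_sum, ← Finset.mul_sum, ← hg, hV]
    ring
  have hupper : ∀ t, 0 < t → Pd (σ + t) ≤ V + t * (g - σ - ν) := by
    intro t ht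
    have h0 : 0 ≤ ∑ i, (φ i - v i)^2 / (α i + σ + t) :=
      Finset.sum_nonneg fun i _ => div_nonneg (sq_nonneg _) (by linarith [hα i])
    rw [hexp t ht]
    have := mul_nonneg (sq_nonneg t) h0
    nlinarith [sq_nonneg t]
  have hlower : ∀ t, 0 < t → V + t * (g - σ - ν) - (1/2) * t^2
      - (1/2) * t^2 * ∑ i, (φ i - v i)^2 / (α i + σ) ≤ Pd (σ + t) := by
    intro t ht
    have hsum : ∑ i, (φ i - v i)^2 / (α i + σ + t) ≤ ∑ i, (φ i - v i)^2 / (α i + σ) := by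
      refine Finset.sum_le_sum fun i _ => ?_
      by_cases h : α i + σ = 0
      · simp [hv i h]
      · have hpos : 0 < α i + σ := lt_of_le_of_ne (hα i) (Ne.symm h)
        exact div_le_div_of_nonneg_left (sq_nonneg _) hpos (by linarith)
    rw [hexp t ht]
    gcongr
  have hLV : L ≤ V := by
    have hcont : Filter.Tendsto (fun s => V + (s - σ) * (g - σ - ν))
        (nhdsWithin σ (Set.Ioi σ)) (nhds V) := by
      have hc : Continuous fun s : ℝ => V + (s - σ) * (g - σ - ν) := by fun_prop
      simpa using (hc.tendsto σ).mono_left nhdsWithin_le_nhds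
    refine le_of_tendsto_of_tendsto hlim hcont
      (Filter.eventually_of_mem self_mem_nhdsWithin fun s hs => ?_)
    simpa using hupper (s - σ) (sub_pos.mpr hs)
  have hD : g - σ - ν ≤ 0 := by
    refine nonpos_of_forall_pos_le_mul
      (K := (1/2) + (1/2) * ∑ i, (φ i - v i)^2 / (α i + σ)) fun t ht => ?_
    have h1 := hlower t ht
    have h2 := hle (σ + t) (by linarith)
    refine le_of_mul_le_mul_left ?_ ht
    linarith
  linarith

/-- Varying one coordinate, the constraint function reaches every level above its value at a
point where that coordinate is minimal. -/
theorem exists_update_sum_eq {n : ℕ} (φ v : Fin n → ℝ) (i : Fin n) (hi : v i = φ i) (c : ℝ)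
    (hc : ∑ j, ((1/2) * (v j)^2 - φ j * v j) ≤ c) :
    ∃ w : Fin n → ℝ, (∀ j, j ≠ i → w j = v j) ∧
      ∑ j, ((1/2) * (w j)^2 - φ j * w j) = c := by
  set g := ∑ j, ((1/2) * (v j)^2 - φ j * v j) with hg
  refine ⟨Function.update v i (φ i + √(2 * (c - g))),
    fun j hj => Function.update_of_ne hj _ _, ?_⟩
  have hs : √(2 * (c - g)) ^ 2 = 2 * (c - g) := Real.sq_sqrt (by linarith)
  rw [← Finset.add_sum_erase _ _ (Finset.mem_univ i)] at hg ⊢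
  rw [Finset.sum_congr rfl (g := fun j => (1/2) * (v j)^2 - φ j * v j)
    fun j hj => by rw [Function.update_of_ne (Finset.ne_of_mem_erase hj)]]
  rw [Function.update_self]
  rw [hi] at hg
  linear_combination (1/2) * hs - hg

/-- Theorem 1, boundary case characterization: with
`I = {i : αᵢ + σ₀ = 0} ≠ ∅`, `ψᵢ + σ₀φᵢ = 0` on `I`, and the supremum of `Πᵈ` over
`(σ₀, ∞)` attained as the (finite) right-hand limit at `σ₀`, a feasible pair `(ξ*, w*)`
is a global minimizer of `Π` over `E_a` iff `ξ* = σ₀`,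
`w_j* = (ψ_j + σ₀φ_j)/(α_j + σ₀)` for all `j ∈ J`, and
`Σ_{i∈I} (½(wᵢ*)² − φᵢwᵢ*) = −Σ_{j∈J} (½(w_j*)² − φ_jw_j*) + σ₀ + ν`; in this case the
optimal value is `−½σ₀² − ½ Σ_{j∈J} (ψ_j + σ₀φ_j)²/(α_j + σ₀) − σ₀ν`. -/
theorem boundary_case_global_minimizers
    (n : ℕ) (α ψ φ : Fin n → ℝ) (ν σ₀ : ℝ)
    (hσ₀ : IsGreatest (Set.range fun i => -α i) σ₀)
    (Pd : ℝ → ℝ)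
    (hPd : ∀ σ, Pd σ = -(1/2) * σ^2 - (1/2) * ∑ i, (ψ i + σ * φ i)^2 / (α i + σ) - ν * σ)
    (Pp : ℝ → (Fin n → ℝ) → ℝ)
    (hPp : ∀ ξ w, Pp ξ w = (1/2) * ξ^2 + ∑ i, ((1/2) * α i * (w i)^2 - ψ i * w i))
    (hI : ∃ i, α i + σ₀ = 0)
    (hψ : ∀ i, α i + σ₀ = 0 → ψ i + σ₀ * φ i = 0)
    (Lv : ℝ)
    (hlim : Filter.Tendsto Pd (nhdsWithin σ₀ (Set.Ioi σ₀)) (nhds Lv))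
    (hsup : IsLUB (Pd '' Set.Ioi σ₀) Lv)
    (ξs : ℝ) (ws : Fin n → ℝ)
    (hfeas : ξs = ∑ i, ((1/2) * (ws i)^2 - φ i * ws i) - ν) :
    ((∀ ξ : ℝ, ∀ w : Fin n → ℝ, ξ = ∑ i, ((1/2) * (w i)^2 - φ i * w i) - ν →
        Pp ξs ws ≤ Pp ξ w)
      ↔ (ξs = σ₀ ∧
          (∀ j, α j + σ₀ ≠ 0 → ws j = (ψ j + σ₀ * φ j) / (α j + σ₀)) ∧
          ∑ i ∈ Finset.univ.filter (fun i => α i + σ₀ = 0),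
              ((1/2) * (ws i)^2 - φ i * ws i)
            = -∑ j ∈ Finset.univ.filter (fun j => α j + σ₀ ≠ 0),
                ((1/2) * (ws j)^2 - φ j * ws j) + σ₀ + ν)) ∧
    ((∀ ξ : ℝ, ∀ w : Fin n → ℝ, ξ = ∑ i, ((1/2) * (w i)^2 - φ i * w i) - ν →
        Pp ξs ws ≤ Pp ξ w) →
      Pp ξs ws = -(1/2) * σ₀^2
        - (1/2) * ∑ j ∈ Finset.univ.filter (fun j => α j + σ₀ ≠ 0),
            (ψ j + σ₀ * φ j)^2 / (α j + σ₀)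
        - σ₀ * ν) := by
  have hα : ∀ i, 0 ≤ α i + σ₀ := fun i => by
    have := hσ₀.2 ⟨i, rfl⟩
    linarith
  have hsplit : ∀ f : Fin n → ℝ, ∑ i ∈ Finset.univ.filter (fun i => α i + σ₀ = 0), f i
      + ∑ j ∈ Finset.univ.filter (fun j => α j + σ₀ ≠ 0), f j = ∑ i, f i := fun f =>
    Finset.sum_filter_add_sum_filter_not _ _ _
  have hval : ∑ j ∈ Finset.univ.filter (fun j => α j + σ₀ ≠ 0),
      (ψ j + σ₀ * φ j)^2 / (α j + σ₀) = ∑ j, (ψ j + σ₀ * φ j)^2 / (α j + σ₀) := by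
    rw [← hsplit fun j => (ψ j + σ₀ * φ j)^2 / (α j + σ₀),
      Finset.sum_eq_zero (s := Finset.univ.filter fun i => α i + σ₀ = 0), zero_add]
    intro i hi
    simp [(Finset.mem_filter.mp hi).2]
  rw [hval]
  set V := -(1/2) * σ₀^2 - (1/2) * ∑ j, (ψ j + σ₀ * φ j)^2 / (α j + σ₀) - σ₀ * ν with hV
  have hid : ∀ ξ w, ξ = ∑ i, ((1/2) * (w i)^2 - φ i * w i) - ν → Pp ξ w = V
      + (1/2) * (ξ - σ₀)^2
      + (1/2) * ∑ i, (α i + σ₀) * (w i - (ψ i + σ₀ * φ i) / (α i + σ₀))^2 := fun ξ w h => by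
    rw [hPp, hV]
    exact primal_eq_add_squares α ψ φ w ν σ₀ ξ hψ h
  have hsq : ∀ (w : Fin n → ℝ) (i : Fin n),
      0 ≤ (α i + σ₀) * (w i - (ψ i + σ₀ * φ i) / (α i + σ₀))^2 :=
    fun w i => mul_nonneg (hα i) (sq_nonneg _)
  have hsq_sum : ∀ w : Fin n → ℝ,
      0 ≤ ∑ i, (α i + σ₀) * (w i - (ψ i + σ₀ * φ i) / (α i + σ₀))^2 :=
    fun w => Finset.sum_nonneg fun i _ => hsq w i
  have hstat : ∀ w : Fin n → ℝ,
      (∀ j, α j + σ₀ ≠ 0 → w j = (ψ j + σ₀ * φ j) / (α j + σ₀)) →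
      ∑ i, (α i + σ₀) * (w i - (ψ i + σ₀ * φ i) / (α i + σ₀))^2 = 0 := fun w hw => by
    refine Finset.sum_eq_zero fun i _ => ?_
    by_cases h : α i + σ₀ = 0
    · rw [h, zero_mul]
    · rw [← hw i h, sub_self]
      ring
  obtain ⟨i₀, hi₀⟩ := hI
  set v : Fin n → ℝ :=
    fun i => if α i + σ₀ = 0 then φ i else (ψ i + σ₀ * φ i) / (α i + σ₀) with hv_def
  have hv : ∀ i, α i + σ₀ = 0 → v i = φ i := fun i h => if_pos h
  have hv' : ∀ i, α i + σ₀ ≠ 0 → v i = (ψ i + σ₀ * φ i) / (α i + σ₀) := fun i h => if_neg h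
  have hle := constraint_le_of_dual_le_limit α ψ φ ν σ₀ Lv hα hψ Pd hPd hlim
    (fun s hs => hsup.1 ⟨s, hs, rfl⟩) v hv hv'
  obtain ⟨w₀, hw₀, hw₀_sum⟩ := exists_update_sum_eq φ v i₀ (hv i₀ hi₀) (σ₀ + ν) hle
  have hw₀_feas : σ₀ = ∑ i, ((1/2) * (w₀ i)^2 - φ i * w₀ i) - ν := by
    rw [hw₀_sum]
    ring
  have hw₀_val : Pp σ₀ w₀ = V := by
    rw [hid σ₀ w₀ hw₀_feas, hstat w₀ fun j hj => ?_]
    · ring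
    · rw [hw₀ j fun h => hj (h ▸ hi₀), hv' j hj]
  have hmin : (∀ ξ : ℝ, ∀ w : Fin n → ℝ, ξ = ∑ i, ((1/2) * (w i)^2 - φ i * w i) - ν →
      Pp ξs ws ≤ Pp ξ w) → (1/2) * (ξs - σ₀)^2
        + (1/2) * ∑ i, (α i + σ₀) * (ws i - (ψ i + σ₀ * φ i) / (α i + σ₀))^2 ≤ 0 := fun h => by
    have h1 := h σ₀ w₀ hw₀_feas
    rw [hw₀_val, hid ξs ws hfeas] at h1
    linarith
  refine ⟨⟨fun h => ?_, fun ⟨hξ, hw, _⟩ ξ w hf => ?_⟩, fun h => ?_⟩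
  · have h1 := hmin h
    have h2 := hsq_sum ws
    have h3 := sq_nonneg (ξs - σ₀)
    have hξ : ξs = σ₀ := by
      have : (ξs - σ₀)^2 = 0 := by linarith
      exact sub_eq_zero.mp (pow_eq_zero_iff two_ne_zero |>.mp this)
    refine ⟨hξ, fun j hj => ?_, ?_⟩
    · have h4 := (Finset.sum_eq_zero_iff_of_nonneg fun i _ => hsq ws i).mp
        (by linarith) j (Finset.mem_univ j)
      exact sub_eq_zero.mp
        (pow_eq_zero_iff two_ne_zero |>.mp ((mul_eq_zero.mp h4).resolve_left hj))
    · have h5 := hsplit fun i => (1/2) * (ws i)^2 - φ i * ws i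
      linarith
  · rw [hid ξs ws hfeas, hid ξ w hf, hstat ws hw, hξ]
    have h2 := hsq_sum w
    have h3 := sq_nonneg (ξ - σ₀)
    linarith
  · have h1 := hmin h
    have h2 := hsq_sum ws
    have h3 := sq_nonneg (ξs - σ₀)
    rw [hid ξs ws hfeas]
    linarith
end

section
/- Let w* be a global minimizer over ℝⁿ of F(w) = ½(Σᵢ₌₁ⁿ (½wᵢ² − φᵢwᵢ) − ν)² + Σᵢ₌₁ⁿ (½αᵢwᵢ² − ψᵢwᵢ). Then for every index i₀ ∈ {1,…,n}, one has (ψ_{i₀} − α_{i₀}φ_{i₀})(w_{i₀}* − φ_{i₀}) ≥ 0. -/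
open scoped BigOperators

/-- If `w*` is a global minimizer of
`F(w) = ½(Σᵢ (½wᵢ² − φᵢwᵢ) − ν)² + Σᵢ (½αᵢwᵢ² − ψᵢwᵢ)` over `ℝⁿ`, then
`(ψ_{i₀} − α_{i₀}φ_{i₀})(w_{i₀}* − φ_{i₀}) ≥ 0` for every `i₀`. -/
theorem global_minimizer_sign_condition
    (n : ℕ) (α ψ φ : Fin n → ℝ) (ν : ℝ)
    (F : (Fin n → ℝ) → ℝ)
    (hF : ∀ w, F w = (1/2) * (∑ i, ((1/2) * (w i)^2 - φ i * w i) - ν)^2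
        + ∑ i, ((1/2) * α i * (w i)^2 - ψ i * w i))
    (ws : Fin n → ℝ) (hmin : ∀ w, F ws ≤ F w) :
    ∀ i₀ : Fin n, (ψ i₀ - α i₀ * φ i₀) * (ws i₀ - φ i₀) ≥ 0 := by
  intro i₀
  have h := hmin (Function.update ws i₀ (2 * φ i₀ - ws i₀))
  rw [hF, hF, ← sub_nonneg] at h
  have quad : ∑ i, ((1/2) * (Function.update ws i₀ (2 * φ i₀ - ws i₀) i)^2
      - φ i * Function.update ws i₀ (2 * φ i₀ - ws i₀) i)
      = ∑ i, ((1/2) * (ws i)^2 - φ i * ws i) := by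
    refine Finset.sum_congr rfl fun i _ => ?_
    rcases eq_or_ne i i₀ with rfl | hi
    · rw [Function.update_self]
      ring
    · rw [Function.update_of_ne hi]
  rw [quad, add_sub_add_left_eq_sub, ← Finset.sum_sub_distrib,
    Finset.sum_eq_single i₀ (fun i _ hi => by rw [Function.update_of_ne hi, sub_self])
      (fun hi => absurd (Finset.mem_univ i₀) hi), Function.update_self] at h
  linarith
end

section
/- The infimum over ℝⁿ of F(w) = ½(Σᵢ₌₁ⁿ (½wᵢ² − φᵢwᵢ) − ν)² + Σᵢ₌₁ⁿ (½αᵢwᵢ² − ψᵢwᵢ) equals the infimum of F over the linearly constrained set {w ∈ ℝⁿ : (ψᵢ − αᵢφᵢ)(wᵢ − φᵢ) ≥ 0 for all i = 1,…,n}. -/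
open scoped BigOperators

/-- The infimum of `F` over `ℝⁿ` equals its infimum over the linearly
constrained set `{w : (ψᵢ − αᵢφᵢ)(wᵢ − φᵢ) ≥ 0 for all i}`. -/
theorem inf_unconstrained_eq_inf_constrained
    (n : ℕ) (α ψ φ : Fin n → ℝ) (ν : ℝ)
    (F : (Fin n → ℝ) → ℝ)
    (hF : ∀ w, F w = (1/2) * (∑ i, ((1/2) * (w i)^2 - φ i * w i) - ν)^2
        + ∑ i, ((1/2) * α i * (w i)^2 - ψ i * w i)) :
    sInf (Set.range F)
      = sInf (F '' {w : Fin n → ℝ | ∀ i, (ψ i - α i * φ i) * (w i - φ i) ≥ 0}) := by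
  refine csInf_eq_csInf_of_forall_exists_le ?_ ?_
  · rintro _ ⟨w, rfl⟩
    let v : Fin n → ℝ := fun i =>
      if 0 ≤ (ψ i - α i * φ i) * (w i - φ i) then w i else 2 * φ i - w i
    refine ⟨F v, ⟨v, fun i => ?_, rfl⟩, ?_⟩
    · by_cases h : 0 ≤ (ψ i - α i * φ i) * (w i - φ i)
      · simpa only [v, if_pos h] using h
      · simp only [v, if_neg h]
        linarith
    · have hquad : ∑ i, ((1/2) * (v i)^2 - φ i * v i)
          = ∑ i, ((1/2) * (w i)^2 - φ i * w i) := by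
        refine Finset.sum_congr rfl fun i _ => ?_
        by_cases h : 0 ≤ (ψ i - α i * φ i) * (w i - φ i)
        · simp only [v, if_pos h]
        · simp only [v, if_neg h]
          ring
      have hlin : ∑ i, ((1/2) * α i * (v i)^2 - ψ i * v i)
          ≤ ∑ i, ((1/2) * α i * (w i)^2 - ψ i * w i) := by
        refine Finset.sum_le_sum fun i _ => ?_
        by_cases h : 0 ≤ (ψ i - α i * φ i) * (w i - φ i)
        · simp only [v, if_pos h, le_refl]
        · simp only [v, if_neg h]
          linarith
      rw [hF v, hF w, hquad]
      gcongr
  · rintro _ ⟨w, -, rfl⟩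
    exact ⟨F w, ⟨w, rfl⟩, le_rfl⟩
end

section
/- Let λ ∈ ℝⁿ satisfy λᵢ + φᵢ²/2 ≥ 0 for all i, and define w(λ) ∈ ℝⁿ by w(λ)ᵢ = φᵢ + √(2λᵢ + φᵢ²) if ψᵢ − αᵢφᵢ ≥ 0 and w(λ)ᵢ = φᵢ − √(2λᵢ + φᵢ²) if ψᵢ − αᵢφᵢ < 0. Then (ψᵢ − αᵢφᵢ)(w(λ)ᵢ − φᵢ) ≥ 0 for all i, and P^{dd}(λ) = F(w(λ)). -/
open scoped BigOperators

/-- For `λ` with `λᵢ + φᵢ²/2 ≥ 0` for all `i`, the point `w(λ)` defined by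
`w(λ)ᵢ = φᵢ ± √(2λᵢ + φᵢ²)` (sign according to the sign of `ψᵢ − αᵢφᵢ`) satisfies the
linear constraints `(ψᵢ − αᵢφᵢ)(w(λ)ᵢ − φᵢ) ≥ 0` and `P^{dd}(λ) = F(w(λ))`. -/
theorem dual_of_dual_maps_into_constrained_primal
    (n : ℕ) (α ψ φ : Fin n → ℝ) (ν : ℝ)
    (F : (Fin n → ℝ) → ℝ)
    (hF : ∀ w, F w = (1/2) * (∑ i, ((1/2) * (w i)^2 - φ i * w i) - ν)^2
        + ∑ i, ((1/2) * α i * (w i)^2 - ψ i * w i))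
    (Pdd : (Fin n → ℝ) → ℝ)
    (hPdd : ∀ l, Pdd l = ∑ i, α i * l i
        - ∑ i, |ψ i - α i * φ i| * Real.sqrt (2 * l i + (φ i)^2)
        + (1/2) * (∑ i, l i - ν)^2
        - ∑ i, (ψ i - α i * φ i) * φ i)
    (l : Fin n → ℝ) (hl : ∀ i, l i + (φ i)^2 / 2 ≥ 0)
    (wl : Fin n → ℝ)
    (hwl : ∀ i, wl i = if 0 ≤ ψ i - α i * φ i
        then φ i + Real.sqrt (2 * l i + (φ i)^2)
        else φ i - Real.sqrt (2 * l i + (φ i)^2)) :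
    (∀ i, (ψ i - α i * φ i) * (wl i - φ i) ≥ 0) ∧ Pdd l = F wl := by
  have key : ∀ i, (wl i - φ i)^2 = 2 * l i + (φ i)^2 ∧
      (ψ i - α i * φ i) * (wl i - φ i)
        = |ψ i - α i * φ i| * Real.sqrt (2 * l i + (φ i)^2) := by
    intro i
    have hs : Real.sqrt (2 * l i + (φ i)^2) ^ 2 = 2 * l i + (φ i)^2 :=
      Real.sq_sqrt (by linarith [hl i])
    rw [hwl i]
    split_ifs with h
    · rw [abs_of_nonneg h, add_sub_cancel_left]
      exact ⟨hs, rfl⟩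
    · rw [abs_of_neg (not_le.mp h), sub_sub_cancel_left, neg_sq]
      exact ⟨hs, by ring⟩
  refine ⟨fun i => ?_, ?_⟩
  · rw [(key i).2]
    positivity
  · have hquad : ∀ i, (1/2) * (wl i)^2 - φ i * wl i = l i := fun i => by
      linear_combination (1/2) * (key i).1
    have hlin : ∀ i, (1/2) * α i * (wl i)^2 - ψ i * wl i
        = α i * l i - |ψ i - α i * φ i| * Real.sqrt (2 * l i + (φ i)^2)
          - (ψ i - α i * φ i) * φ i := fun i => by
      linear_combination α i * hquad i - (key i).2
    rw [hPdd, hF]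
    simp only [hquad, hlin, Finset.sum_sub_distrib]
    ring
end

section
/- Let w ∈ ℝⁿ satisfy (ψᵢ − αᵢφᵢ)(wᵢ − φᵢ) ≥ 0 for all i, and define λ(w) ∈ ℝⁿ by λ(w)ᵢ = ½(wᵢ − φᵢ)² − φᵢ²/2. Then λ(w)ᵢ + φᵢ²/2 ≥ 0 for all i, and F(w) = P^{dd}(λ(w)). -/
open scoped BigOperators

/-- For `w` with `(ψᵢ − αᵢφᵢ)(wᵢ − φᵢ) ≥ 0` for all `i`, the point
`λ(w)ᵢ = ½(wᵢ − φᵢ)² − φᵢ²/2` satisfies `λ(w)ᵢ + φᵢ²/2 ≥ 0` and `F(w) = P^{dd}(λ(w))`. -/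
theorem constrained_primal_maps_into_dual_of_dual
    (n : ℕ) (α ψ φ : Fin n → ℝ) (ν : ℝ)
    (F : (Fin n → ℝ) → ℝ)
    (hF : ∀ w, F w = (1/2) * (∑ i, ((1/2) * (w i)^2 - φ i * w i) - ν)^2
        + ∑ i, ((1/2) * α i * (w i)^2 - ψ i * w i))
    (Pdd : (Fin n → ℝ) → ℝ)
    (hPdd : ∀ l, Pdd l = ∑ i, α i * l i
        - ∑ i, |ψ i - α i * φ i| * Real.sqrt (2 * l i + (φ i)^2)
        + (1/2) * (∑ i, l i - ν)^2
        - ∑ i, (ψ i - α i * φ i) * φ i)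
    (w : Fin n → ℝ) (hw : ∀ i, (ψ i - α i * φ i) * (w i - φ i) ≥ 0)
    (lw : Fin n → ℝ)
    (hlw : ∀ i, lw i = (1/2) * (w i - φ i)^2 - (φ i)^2 / 2) :
    (∀ i, lw i + (φ i)^2 / 2 ≥ 0) ∧ F w = Pdd lw := by
  refine ⟨fun i => by rw [hlw i]; nlinarith [sq_nonneg (w i - φ i)], ?_⟩
  have hlw' (i) : lw i = (1/2) * (w i)^2 - φ i * w i := by rw [hlw i]; ring
  have hsqrt (i) : |ψ i - α i * φ i| * Real.sqrt (2 * lw i + (φ i)^2)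
      = (ψ i - α i * φ i) * (w i - φ i) := by
    rw [show 2 * lw i + (φ i)^2 = (w i - φ i)^2 by rw [hlw i]; ring, Real.sqrt_sq_eq_abs,
      ← abs_mul, abs_of_nonneg (hw i)]
  have hlin : ∑ i, ((1/2) * α i * (w i)^2 - ψ i * w i)
      = ∑ i, α i * lw i - ∑ i, (ψ i - α i * φ i) * (w i - φ i)
        - ∑ i, (ψ i - α i * φ i) * φ i := by
    rw [← Finset.sum_sub_distrib, ← Finset.sum_sub_distrib]
    refine Finset.sum_congr rfl fun i _ => ?_
    rw [hlw' i]; ring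
  rw [hF, hPdd, hlin]
  simp_rw [hsqrt, ← hlw']
  ring
end

section
/- (Theorem 2) The infimum of P^{dd}(λ) over the set {λ ∈ ℝⁿ : λᵢ + φᵢ²/2 ≥ 0 for all i = 1,…,n} equals the infimum of F(w) over the set {w ∈ ℝⁿ : (ψᵢ − αᵢφᵢ)(wᵢ − φᵢ) ≥ 0 for all i = 1,…,n}. -/
open scoped BigOperators

/-- On the half-line where `c` and `w - f` have the same sign, `|c| |w - f| = c (w - f)`, with
`|w - f|` written as the square root of twice the value of `w²/2 - f w` plus `f²`. -/
theorem abs_mul_sqrt_eq_mul_sub {c w f : ℝ} (h : c * (w - f) ≥ 0) :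
    |c| * √(2 * ((1/2) * w^2 - f * w) + f^2) = c * (w - f) := by
  rw [show 2 * ((1/2) * w^2 - f * w) + f^2 = (w - f)^2 by ring, Real.sqrt_sq_eq_abs, ← abs_mul,
    abs_of_nonneg h]

/-- Every value `l ≥ -f²/2` of `w²/2 - f w` is attained on the side of `f` prescribed by the sign
of `c`. -/
theorem exists_quadratic_eq (c : ℝ) {l f : ℝ} (h : l + f^2 / 2 ≥ 0) :
    ∃ w : ℝ, c * (w - f) ≥ 0 ∧ (1/2) * w^2 - f * w = l := by
  have hsq : √(2 * l + f^2) ^ 2 = 2 * l + f^2 := Real.sq_sqrt (by linarith)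
  rcases le_total 0 c with hc | hc
  · refine ⟨f + √(2 * l + f^2), ?_, by linear_combination (1/2) * hsq⟩
    rw [add_sub_cancel_left]
    positivity
  · refine ⟨f - √(2 * l + f^2), ?_, by linear_combination (1/2) * hsq⟩
    rw [sub_sub_cancel_left]
    exact mul_nonneg_of_nonpos_of_nonpos hc (neg_nonpos.2 (Real.sqrt_nonneg _))

/-- Theorem 2: The infimum of `P^{dd}` over
`{λ : λᵢ + φᵢ²/2 ≥ 0 for all i}` equals the infimum of `F` over
`{w : (ψᵢ − αᵢφᵢ)(wᵢ − φᵢ) ≥ 0 for all i}`. -/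
theorem dual_of_dual_equiv_constrained_primal
    (n : ℕ) (α ψ φ : Fin n → ℝ) (ν : ℝ)
    (F : (Fin n → ℝ) → ℝ)
    (hF : ∀ w, F w = (1/2) * (∑ i, ((1/2) * (w i)^2 - φ i * w i) - ν)^2
        + ∑ i, ((1/2) * α i * (w i)^2 - ψ i * w i))
    (Pdd : (Fin n → ℝ) → ℝ)
    (hPdd : ∀ l, Pdd l = ∑ i, α i * l i
        - ∑ i, |ψ i - α i * φ i| * Real.sqrt (2 * l i + (φ i)^2)
        + (1/2) * (∑ i, l i - ν)^2
        - ∑ i, (ψ i - α i * φ i) * φ i) :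
    sInf (Pdd '' {l : Fin n → ℝ | ∀ i, l i + (φ i)^2 / 2 ≥ 0})
      = sInf (F '' {w : Fin n → ℝ | ∀ i, (ψ i - α i * φ i) * (w i - φ i) ≥ 0}) := by
  have key : ∀ w : Fin n → ℝ, (∀ i, (ψ i - α i * φ i) * (w i - φ i) ≥ 0) →
      F w = Pdd (fun i => (1/2) * (w i)^2 - φ i * w i) := by
    intro w hw
    have hsum : ∑ i, ((1/2) * α i * (w i)^2 - ψ i * w i)
        = ∑ i, α i * ((1/2) * (w i)^2 - φ i * w i)
          - ∑ i, |ψ i - α i * φ i| * √(2 * ((1/2) * (w i)^2 - φ i * w i) + (φ i)^2)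
          - ∑ i, (ψ i - α i * φ i) * φ i := by
      rw [← Finset.sum_sub_distrib, ← Finset.sum_sub_distrib]
      refine Finset.sum_congr rfl fun i _ => ?_
      rw [abs_mul_sqrt_eq_mul_sub (hw i)]
      ring
    rw [hF, hPdd, hsum]
    ring
  congr 1
  ext y
  constructor
  · rintro ⟨l, hl, rfl⟩
    choose w hw hwl using fun i => exists_quadratic_eq (ψ i - α i * φ i) (hl i)
    exact ⟨w, hw, by rw [key w hw, funext hwl]⟩
  · rintro ⟨w, hw, rfl⟩
    refine ⟨_, fun i => ?_, (key w hw).symm⟩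
    nlinarith [sq_nonneg (w i - φ i)]
end

section
/- (Weak duality between the dual pair) For every σ ∈ ℝ with αᵢ + σ > 0 for all i, and every λ ∈ ℝⁿ with λᵢ + φᵢ²/2 ≥ 0 for all i, one has Πᵈ(σ) ≤ P^{dd}(λ), where Πᵈ(σ) = −½σ² − ½ Σᵢ₌₁ⁿ (ψᵢ + σφᵢ)²/(αᵢ + σ) − νσ and P^{dd}(λ) = Σᵢ₌₁ⁿ αᵢλᵢ − Σᵢ₌₁ⁿ |ψᵢ − αᵢφᵢ|·√(2λᵢ + φᵢ²) + ½(Σᵢ₌₁ⁿ λᵢ − ν)² − Σᵢ₌₁ⁿ (ψᵢ − αᵢφᵢ)φᵢ. -/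
open scoped BigOperators

/-- A single summand of the dual function is bounded above by the corresponding summand of the
Lagrangian, after completing the square in `√(2l + φ²)`. -/
theorem neg_half_sq_div_le_s19 {a σ ψ φ l : ℝ} (ha : 0 < a + σ) (hl : 0 ≤ l + φ ^ 2 / 2) :
    -(1 / 2) * ((ψ + σ * φ) ^ 2 / (a + σ))
      ≤ a * l - |ψ - a * φ| * Real.sqrt (2 * l + φ ^ 2) - (ψ - a * φ) * φ + σ * l := by
  have hs : Real.sqrt (2 * l + φ ^ 2) ^ 2 = 2 * l + φ ^ 2 := Real.sq_sqrt (by linarith)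
  have hd : |ψ - a * φ| ^ 2 = (ψ - a * φ) ^ 2 := sq_abs _
  generalize Real.sqrt (2 * l + φ ^ 2) = s at hs ⊢
  generalize |ψ - a * φ| = d at hd ⊢
  have hgap : a * l - d * s - (ψ - a * φ) * φ + σ * l
      + (1 / 2) * ((ψ + σ * φ) ^ 2 / (a + σ)) = ((a + σ) * s - d) ^ 2 / (2 * (a + σ)) := by
    field_simp
    linear_combination -(a + σ) ^ 2 * hs - hd
  have : 0 ≤ ((a + σ) * s - d) ^ 2 / (2 * (a + σ)) := by positivity
  linarith

/-- Weak duality between the dual pair: For every `σ` with `αᵢ + σ > 0`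
for all `i` and every `λ` with `λᵢ + φᵢ²/2 ≥ 0` for all `i`, `Πᵈ(σ) ≤ P^{dd}(λ)`. -/
theorem weak_duality_dual_pair
    (n : ℕ) (α ψ φ : Fin n → ℝ) (ν : ℝ)
    (σ : ℝ) (hσ : ∀ i, α i + σ > 0)
    (l : Fin n → ℝ) (hl : ∀ i, l i + (φ i)^2 / 2 ≥ 0) :
    -(1/2) * σ^2 - (1/2) * ∑ i, (ψ i + σ * φ i)^2 / (α i + σ) - ν * σ
      ≤ ∑ i, α i * l i
        - ∑ i, |ψ i - α i * φ i| * Real.sqrt (2 * l i + (φ i)^2)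
        + (1/2) * (∑ i, l i - ν)^2
        - ∑ i, (ψ i - α i * φ i) * φ i := by
  have hsum := Finset.sum_le_sum fun i (_ : i ∈ Finset.univ) ↦
    neg_half_sq_div_le_s19 (ψ := ψ i) (hσ i) (hl i)
  simp only [Finset.sum_add_distrib, Finset.sum_sub_distrib, ← Finset.mul_sum] at hsum
  linarith [sq_nonneg (∑ i, l i - ν - σ)]
end
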